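/- Let χ be a linear functional on W of height -1 or 0 (so that Λ(χ) = F_p) and let λ ∈ Λ(χ). Then Ext(K_λ, V_χ(λ)), taken in the category of W_0-modules with p-character χ (with V_χ(λ) regarded as a W_0-module by restriction), is isomorphic to K if λ ∈ {0, p-1}, and is 0 otherwise. -/

import Mathlib

/-!
Common setup: the Witt algebra `W` over `K` (char `p > 3`) has basis
`e_{-1}, e_0, ..., e_{p-2}` with `[e_i, e_j] = (j-i) e_{i+j}` (and `e_k = 0`
outside the range), and `p`-mapping `e_i^{[p]} = δ_{i0} e_i`.  A module with
`p`-character `χ` over `W` (resp. the subalgebra `W_0 = <e_0, ..., e_{p-2}>`)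
is given by a family of endomorphisms `ρ k` (`k : ℤ`, vanishing outside
`[lo, p-2]` where `lo = -1` for `W` and `lo = 0` for `W_0`) satisfying the
bracket relations and `(ρ i)^p - δ_{i0} ρ i = χ(e_i)^p • 1`.

The Baer Ext space `Ext(N, M)` of two such modules, in the category of
modules with `p`-character `χ`, is realized concretely: an extension
`0 → M → E → N → 0` admits a linear splitting `E ≃ M ⊕ N`, under which the
action of `e_k` is `(m, n) ↦ (ρM k m + c k n, ρN k n)` for a "cocycle"
`c : ℤ → (N →ₗ M)`; the conditions for `E` to be a module with `p`-character
`χ` are the cocycle conditions below, Baer equivalence corresponds to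
differing by a coboundary, and the Baer sum / scalar action correspond to the
linear structure on cocycles.  So `Ext(N, M) ≅ cocycles / coboundaries`.
-/

set_option maxHeartbeats 1000000
set_option synthInstance.maxHeartbeats 1000000

noncomputable section

/-- The coefficient `(-1)^j · (i!/(i-j)!) · ((j+1)λ - i + j)` of the action
`e_j · v_i = (coefficient) · v_{i-j}` on the reduced Verma module; it vanishes
for `j > i` since then `Nat.descFactorial i j = 0`. -/
def wCoef (K : Type) [Field K] (lam : K) (j i : ℕ) : K :=
  (-1 : K) ^ j * (Nat.descFactorial i j : K) * (((j : K) + 1) * lam - (i : K) + (j : K))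

/-- Matrices (in the basis `v_0, ..., v_{p-1}`) of the generators `e_j`
(`j : ℤ`) acting on the reduced Verma module `V_χ(λ)`; here `c = χ(e_{-1})^p`.
`e_{-1} v_i = v_{i+1}` for `i < p-1`, `e_{-1} v_{p-1} = c v_0`, and for
`0 ≤ j ≤ p-2`, `e_j v_i = (-1)^j (i!/(i-j)!) ((j+1)λ - i + j) v_{i-j}`. -/
def vermaMat (K : Type) [Field K] (p : ℕ) (c lam : K) : ℤ → Matrix (Fin p) (Fin p) K :=
  fun j =>
    if j = -1 then
      Matrix.of fun k l =>
        if (k : ℕ) = (l : ℕ) + 1 then 1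
        else if (k : ℕ) = 0 ∧ (l : ℕ) = p - 1 then c else 0
    else if 0 ≤ j ∧ j ≤ (p : ℤ) - 2 then
      Matrix.of fun k l =>
        if (l : ℕ) = (k : ℕ) + j.toNat then wCoef K lam j.toNat (l : ℕ) else 0
    else 0

/-- The action of the basis elements `e_j` (`j : ℤ`) on the reduced Verma
module `V_χ(λ)`, with `c = χ(e_{-1})^p`. -/
def vermaRho (K : Type) [Field K] (p : ℕ) (c lam : K) : ℤ → Module.End K (Fin p → K) :=
  fun j => Matrix.toLin' (vermaMat K p c lam j)

/-- The one-dimensional `W_0`-module `K_λ`: `e_0` acts by `λ`, all other `e_j` act by `0`. -/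
def oneDimRho (K : Type) [Field K] (lam : K) : ℤ → Module.End K K :=
  fun j => if j = 0 then lam • (1 : Module.End K K) else 0

/-- The one-dimensional trivial module: every basis element acts by `0`. -/
def trivRho (K : Type) [Field K] : ℤ → Module.End K K := fun _ => 0

/-- The coefficient `(-1)^(j+1) · ((i+1)!/(i-j)!)` of the action
`e_j · u_i = (coefficient) · u_{i-j}` on the `(p-1)`-dimensional simple module `S`. -/
def sCoef (K : Type) [Field K] (j i : ℕ) : K :=
  (-1 : K) ^ (j + 1) * (Nat.descFactorial (i + 1) (j + 1) : K)

/-- Matrices (in the basis `u_0, ..., u_{p-2}`) of the generators `e_j` acting on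
the `(p-1)`-dimensional simple restricted module `S = V_0(p-1)/Soc(V_0(p-1))`. -/
def sMat (K : Type) [Field K] (p : ℕ) : ℤ → Matrix (Fin (p - 1)) (Fin (p - 1)) K :=
  fun j =>
    if j = -1 then
      Matrix.of fun k l => if (k : ℕ) = (l : ℕ) + 1 then 1 else 0
    else if 0 ≤ j ∧ j ≤ (p : ℤ) - 2 then
      Matrix.of fun k l =>
        if (l : ℕ) = (k : ℕ) + j.toNat then sCoef K j.toNat (l : ℕ) else 0
    else 0

/-- The action of the basis elements `e_j` on the simple module `S`. -/
def sRho (K : Type) [Field K] (p : ℕ) : ℤ → Module.End K (Fin (p - 1) → K) :=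
  fun j => Matrix.toLin' (sMat K p j)

section ExtSpace

variable (K : Type) [Field K] (M N : Type) [AddCommGroup M] [Module K M]
  [AddCommGroup N] [Module K N]

/-- Constraint: a cocycle vanishes outside the index range `[lo, p-2]`. -/
def suppConstraint (p : ℕ) (lo k : ℤ) : (ℤ → N →ₗ[K] M) →ₗ[K] (N →ₗ[K] M) :=
  if k < lo ∨ (p : ℤ) - 2 < k then LinearMap.proj k else 0

variable {M N}

/-- Constraint on a cocycle coming from the bracket relation
`[e_i, e_j] = (j - i) e_{i+j}`:
`(j-i) c(i+j) = ρM i ∘ c j + c i ∘ ρN j - ρM j ∘ c i - c j ∘ ρN i`. -/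
def bracketConstraint (p : ℕ) (lo : ℤ) (ρM : ℤ → Module.End K M)
    (ρN : ℤ → Module.End K N) (i j : ℤ) :
    (ℤ → N →ₗ[K] M) →ₗ[K] (N →ₗ[K] M) :=
  if lo ≤ i ∧ i ≤ (p : ℤ) - 2 ∧ lo ≤ j ∧ j ≤ (p : ℤ) - 2 then
    ((j - i : ℤ) : K) • LinearMap.proj (i + j)
      - LinearMap.llcomp K N M M (ρM i) ∘ₗ LinearMap.proj j
      - LinearMap.lcomp K M (ρN j) ∘ₗ LinearMap.proj i
      + LinearMap.llcomp K N M M (ρM j) ∘ₗ LinearMap.proj i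
      + LinearMap.lcomp K M (ρN i) ∘ₗ LinearMap.proj j
  else 0

/-- Constraint on a cocycle expressing that the extension has `p`-character `χ`:
on the extension `E = M ⊕ N` the `(N → M)`-component of `(e_i)^p` is
`∑_{k<p} (ρM i)^k ∘ c i ∘ (ρN i)^(p-1-k)`, and this must agree with the
`(N → M)`-component of `e_i^{[p]} + χ(e_i)^p • 1`, which is `δ_{i0} c i`
(the scalar `χ(e_i)^p` contributes nothing off the diagonal, and the diagonal
blocks hold since `M`, `N` have `p`-character `χ`). -/
def pcharConstraint (p : ℕ) (lo : ℤ) (ρM : ℤ → Module.End K M)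
    (ρN : ℤ → Module.End K N) (i : ℤ) :
    (ℤ → N →ₗ[K] M) →ₗ[K] (N →ₗ[K] M) :=
  if lo ≤ i ∧ i ≤ (p : ℤ) - 2 then
    (∑ k ∈ Finset.range p,
        LinearMap.llcomp K N M M ((ρM i) ^ k) ∘ₗ
          LinearMap.lcomp K M ((ρN i) ^ (p - 1 - k)) ∘ₗ LinearMap.proj i)
      - (if i = 0 then (LinearMap.proj 0 : (ℤ → N →ₗ[K] M) →ₗ[K] (N →ₗ[K] M)) else 0)
  else 0

/-- The space of cocycles: families `c : ℤ → (N →ₗ M)` (the values of a linear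
map `W → Hom(N, M)` on the basis, `lo = -1` for `W` and `lo = 0` for `W_0`)
such that `M ⊕ N` with action `e_k (m, n) = (ρM k m + c k n, ρN k n)` is a
module with `p`-character `χ`. -/
def cocycles (p : ℕ) (lo : ℤ) (ρM : ℤ → Module.End K M) (ρN : ℤ → Module.End K N) :
    Submodule K (ℤ → N →ₗ[K] M) :=
  (⨅ k : ℤ, LinearMap.ker (suppConstraint K M N p lo k)) ⊓
    (⨅ i : ℤ, ⨅ j : ℤ, LinearMap.ker (bracketConstraint K p lo ρM ρN i j)) ⊓
    (⨅ i : ℤ, LinearMap.ker (pcharConstraint K p lo ρM ρN i))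

/-- The coboundaries: cocycles of the form `k ↦ ρM k ∘ f - f ∘ ρN k` for a
linear map `f : N → M`; these are exactly the cocycles of split extensions,
and two cocycles give Baer-equivalent extensions iff they differ by a
coboundary. -/
def coboundaries (p : ℕ) (lo : ℤ) (ρM : ℤ → Module.End K M) (ρN : ℤ → Module.End K N) :
    Submodule K (ℤ → N →ₗ[K] M) :=
  LinearMap.range (LinearMap.pi fun k : ℤ =>
    if lo ≤ k ∧ k ≤ (p : ℤ) - 2 then
      LinearMap.llcomp K N M M (ρM k) - LinearMap.lcomp K M (ρN k)
    else 0)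

/-- The Baer Ext space `Ext(N, M)` in the category of modules with
`p`-character `χ` (over `W` if `lo = -1`, over `W_0` if `lo = 0`), realized
as cocycles modulo coboundaries. -/
abbrev extSpace (p : ℕ) (lo : ℤ) (ρM : ℤ → Module.End K M) (ρN : ℤ → Module.End K N) :=
  (cocycles K p lo ρM ρN) ⧸
    (Submodule.comap (cocycles K p lo ρM ρN).subtype (coboundaries K p lo ρM ρN))

end ExtSpace

end

section WittVerma

open Finset

variable {K : Type} [Field K]

/-- The vector of `V_χ(λ)` whose coordinate at `(-1)^n / n! • v_n` is `g (p - n)`. -/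
def wittVec (p : ℕ) (g : ℕ → K) : Fin p → K :=
  fun n => g (p - n) * ((-1) ^ (n : ℕ) / (Nat.factorial n : K))

/-- The action of `e_j` on `V_χ(λ)` in the coordinates of `wittVec`. -/
def wittShift (lam : K) (j : ℕ) (g : ℕ → K) : ℕ → K :=
  fun k => if j < k then (((j : K) + 1) * lam + k) * g (k - j) else 0

theorem wittVec_zero (p : ℕ) : wittVec p (0 : ℕ → K) = 0 := by
  ext n; simp [wittVec]

theorem wittVec_add (p : ℕ) (g h : ℕ → K) :
    wittVec p (g + h) = wittVec p g + wittVec p h := by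
  ext n; simp [wittVec, add_mul]

theorem wittVec_smul (p : ℕ) (t : K) (g : ℕ → K) :
    wittVec p (t • g) = t • wittVec p g := by
  ext n; simp [wittVec, mul_assoc]

theorem wittVec_sub (p : ℕ) (g h : ℕ → K) :
    wittVec p (g - h) = wittVec p g - wittVec p h := by
  ext n; simp [wittVec, sub_mul]

theorem wittVec_sum {ι : Type} (p : ℕ) (s : Finset ι) (g : ι → ℕ → K) :
    wittVec p (∑ i ∈ s, g i) = ∑ i ∈ s, wittVec p (g i) := by
  ext n; simp [wittVec, sum_mul]

theorem natCast_ne_zero_of_lt (p : ℕ) [CharP K p] {n : ℕ} (h0 : 0 < n) (hn : n < p) :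
    (n : K) ≠ 0 := fun h =>
  absurd (Nat.le_of_dvd h0 ((CharP.cast_eq_zero_iff K p n).1 h)) (by omega)

theorem factorial_cast_ne_zero (p : ℕ) [CharP K p] {n : ℕ} (hn : n < p) :
    (Nat.factorial n : K) ≠ 0 := by
  induction n with
  | zero => simp
  | succ n ih =>
    rw [Nat.factorial_succ, Nat.cast_mul]
    exact mul_ne_zero (natCast_ne_zero_of_lt p n.succ_pos hn) (ih (by omega))

theorem wittVec_eq_iff (p : ℕ) [CharP K p] {g h : ℕ → K} :
    wittVec p g = wittVec p h ↔ ∀ k, 1 ≤ k → k ≤ p → g k = h k := by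
  constructor
  · intro H k h1 hk
    have := congrFun H ⟨p - k, by omega⟩
    simp only [wittVec] at this
    rw [show p - (p - k) = k by omega] at this
    exact mul_right_cancel₀ (div_ne_zero (pow_ne_zero _ (neg_ne_zero.2 one_ne_zero))
      (factorial_cast_ne_zero p (by omega))) this
  · intro H
    ext n
    simp only [wittVec]
    rw [H (p - n) (by omega) (by omega)]

theorem wittVec_surjective (p : ℕ) [CharP K p] :
    Function.Surjective (wittVec p : (ℕ → K) → Fin p → K) := by
  intro w
  refine ⟨fun k => if h : p - k < p then
    w ⟨p - k, h⟩ / ((-1) ^ (p - k) / (Nat.factorial (p - k) : K)) else 0, ?_⟩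
  ext n
  have hn : p - (p - (n : ℕ)) = n := by omega
  simp only [wittVec, hn, n.isLt, dite_true]
  exact div_mul_cancel₀ _ (div_ne_zero (pow_ne_zero _ (neg_ne_zero.2 one_ne_zero))
      (factorial_cast_ne_zero p n.isLt))

theorem vermaRho_wittVec (p : ℕ) [CharP K p] (c lam : K) {j : ℤ} (h0 : 0 ≤ j)
    (hj : j ≤ (p : ℤ) - 2) (g : ℕ → K) :
    vermaRho K p c lam j (wittVec p g) = wittVec p (wittShift lam j.toNat g) := by
  lift j to ℕ using h0
  ext n
  have hne : (j : ℤ) ≠ -1 := by omega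
  simp only [vermaRho, vermaMat, hne, if_false, Int.natCast_nonneg, hj, and_self, if_true,
    Matrix.toLin'_apply, Matrix.mulVec, dotProduct, Matrix.of_apply, Int.toNat_natCast, ite_mul,
    zero_mul, wittShift, wittVec]
  by_cases hnj : (n : ℕ) + j < p
  · rw [sum_eq_single (⟨n + j, hnj⟩ : Fin p) (fun b _ hb => if_neg fun h => hb (Fin.ext h))
      (by simp), if_pos rfl, if_pos (by omega)]
    have hf := factorial_cast_ne_zero (K := K) p n.isLt
    have hf2 := factorial_cast_ne_zero (K := K) p hnj
    have hd := Nat.factorial_mul_descFactorial (n := n + j) (k := j) (by omega)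
    rw [Nat.add_sub_cancel] at hd
    have hd' : ((n : ℕ).factorial : K) * ((n + j : ℕ).descFactorial j : K)
        = ((n + j : ℕ).factorial : K) := by rw [← Nat.cast_mul, hd]
    have hs : ((-1 : K) ^ j) * (-1) ^ j = 1 := by rw [← mul_pow]; simp
    rw [show p - (n : ℕ) - j = p - (n + j) by omega, Nat.cast_sub n.isLt.le, CharP.cast_eq_zero K p,
      wCoef]
    simp only [pow_add]
    rw [← hd'] at hf2 ⊢
    have hf3 := right_ne_zero_of_mul hf2
    push_cast
    field_simp
    linear_combination ((j + 1) * lam - n) * g (p - (n + j)) * hs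
  · rw [sum_eq_zero fun b _ => if_neg (by omega), if_neg (by omega)]

theorem vermaRho_pow_wittVec (p : ℕ) [CharP K p] (c lam : K) {j : ℤ} (h0 : 0 ≤ j)
    (hj : j ≤ (p : ℤ) - 2) (m : ℕ) (g : ℕ → K) :
    ((vermaRho K p c lam j) ^ m) (wittVec p g)
      = wittVec p ((wittShift lam j.toNat)^[m] g) := by
  induction m with
  | zero => simp
  | succ m ih =>
    rw [pow_succ', Module.End.mul_apply, ih, vermaRho_wittVec p c lam h0 hj,
      Function.iterate_succ_apply']

theorem wittShift_zero_iterate (lam : K) (g : ℕ → K) (m : ℕ) {k : ℕ} (hk : 1 ≤ k) :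
    (wittShift lam 0)^[m] g k = (lam + k) ^ m * g k := by
  induction m with
  | zero => simp
  | succ m ih =>
    rw [Function.iterate_succ_apply', wittShift, if_pos (by omega), Nat.sub_zero, ih]
    push_cast; ring

theorem wittShift_iterate_eq_zero (lam : K) (g : ℕ → K) (j m : ℕ) {k : ℕ} (h1 : 1 ≤ k)
    (hk : k ≤ m * j) : (wittShift lam j)^[m] g k = 0 := by
  induction m generalizing k with
  | zero => omega
  | succ m ih =>
    rw [Function.iterate_succ_apply', wittShift]
    split_ifs with h
    · rw [ih (by omega) (by rw [add_mul] at hk; omega), mul_zero]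
    · rfl

theorem wittShift_one_iterate (lam : K) (g : ℕ → K) (m : ℕ) :
    (wittShift lam 1)^[m] g (m + 1) = (∏ l ∈ range m, (2 * lam + l + 2)) * g 1 := by
  induction m with
  | zero => simp
  | succ m ih =>
    rw [Function.iterate_succ_apply', wittShift, if_pos (by omega), Nat.add_sub_cancel, ih,
      prod_range_succ]
    push_cast; ring

theorem oneDimRho_pow_apply (lam : K) (i : ℤ) (m : ℕ) (x : K) :
    ((oneDimRho K lam i) ^ m) x = (if i = 0 then lam else 0) ^ m * x := by
  induction m with
  | zero => simp
  | succ m ih =>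
    rw [pow_succ', Module.End.mul_apply, ih, oneDimRho]
    split_ifs <;> simp [pow_succ']; ring

/-- The cocycle conditions for extensions of `K_λ` by `V_χ(λ)` in the coordinates of `wittVec`. -/
theorem mem_cocycles_iff (p : ℕ) [CharP K p] (hp : 3 < p) (c lam : K)
    (z : ℤ → K →ₗ[K] (Fin p → K)) (g : ℤ → ℕ → K) (hg : ∀ k, z k 1 = wittVec p (g k)) :
    z ∈ cocycles K p 0 (vermaRho K p c lam) (oneDimRho K lam) ↔
      (∀ k : ℤ, k < 0 ∨ (p : ℤ) - 2 < k → ∀ m, 1 ≤ m → m ≤ p → g k m = 0) ∧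
      (∀ i j : ℕ, i + 2 ≤ p → j + 2 ≤ p → ∀ m, 1 ≤ m → m ≤ p →
        ((j : K) - i) * g (i + j : ℕ) m - wittShift lam i (g j) m
          - (if j = 0 then lam else 0) * g i m + wittShift lam j (g i) m
          + (if i = 0 then lam else 0) * g j m = 0) ∧
      (∀ i : ℕ, i + 2 ≤ p → ∀ m, 1 ≤ m → m ≤ p →
        ∑ k ∈ range p, (if i = 0 then lam else 0) ^ (p - 1 - k) * (wittShift lam i)^[k] (g i) m
          - (if i = 0 then g 0 m else 0) = 0) := by
  have hz (k : ℤ) (x : K) : z k x = x • wittVec p (g k) := by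
    rw [← hg, ← map_smul, smul_eq_mul, mul_one]
  have hN (i : ℤ) : oneDimRho K lam i 1 = if i = 0 then lam else 0 := by
    simpa using oneDimRho_pow_apply lam i 1 1
  have hv (h : ℕ → K) : wittVec p h = 0 ↔ ∀ m, 1 ≤ m → m ≤ p → h m = 0 := by
    rw [← wittVec_zero, wittVec_eq_iff p]; rfl
  simp only [cocycles, Submodule.mem_inf, Submodule.mem_iInf, LinearMap.mem_ker, and_assoc]
  refine and_congr (forall_congr' fun k => ?_) (and_congr ⟨fun H i j hi hj => ?_, fun H i j => ?_⟩
    ⟨fun H i hi => ?_, fun H i => ?_⟩)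
  · rw [suppConstraint]
    split_ifs with h
    · simp only [h, true_imp_iff]
      rw [LinearMap.proj_apply, ← hv, ← hg]
      exact ⟨fun H => by rw [H]; rfl, fun H => LinearMap.ext_ring H⟩
    · simp [h]
  · have H := LinearMap.congr_fun (H i j) 1
    rw [bracketConstraint, if_pos (by omega)] at H
    simp only [LinearMap.sub_apply, LinearMap.add_apply, LinearMap.smul_apply,
      LinearMap.comp_apply, LinearMap.proj_apply, LinearMap.llcomp_apply, LinearMap.lcomp_apply,
      LinearMap.zero_apply, hz, hN, one_smul] at H
    rw [vermaRho_wittVec p c lam (by omega) (by omega),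
      vermaRho_wittVec p c lam (by omega) (by omega)] at H
    simp only [← wittVec_smul, ← wittVec_sub, ← wittVec_add] at H
    intro m h1 hm
    have := (hv _).1 H m h1 hm
    simpa [ite_apply] using this
  · rw [bracketConstraint]
    split_ifs with h
    · lift i to ℕ using h.1
      lift j to ℕ using h.2.2.1
      apply LinearMap.ext_ring
      simp only [LinearMap.sub_apply, LinearMap.add_apply, LinearMap.smul_apply,
        LinearMap.comp_apply, LinearMap.proj_apply, LinearMap.llcomp_apply, LinearMap.lcomp_apply,
        LinearMap.zero_apply, hz, hN, one_smul]
      rw [vermaRho_wittVec p c lam (by omega) (by omega),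
        vermaRho_wittVec p c lam (by omega) (by omega)]
      simp only [← wittVec_smul, ← wittVec_sub, ← wittVec_add]
      refine (hv _).2 fun m h1 hm => ?_
      have := H i j (by omega) (by omega) m h1 hm
      simpa [ite_apply] using this
    · rfl
  · have H := LinearMap.congr_fun (H i) 1
    rw [pcharConstraint, if_pos (by omega)] at H
    simp only [LinearMap.sub_apply, LinearMap.sum_apply,
      LinearMap.comp_apply, LinearMap.proj_apply, LinearMap.llcomp_apply, LinearMap.lcomp_apply,
      LinearMap.zero_apply, hz, oneDimRho_pow_apply, mul_one, map_smul] at H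
    simp only [vermaRho_pow_wittVec p c lam (show (0 : ℤ) ≤ i by omega) (by omega)] at H
    intro m h1 hm
    rcases eq_or_ne i 0 with rfl | hi0
    · simp only [Nat.cast_zero, if_true, LinearMap.proj_apply, hz, one_smul] at H
      simp only [← wittVec_smul, ← wittVec_sub, ← wittVec_sum] at H
      have := (hv _).1 H m h1 hm
      simpa using this
    · simp only [Nat.cast_eq_zero, hi0, if_false, LinearMap.zero_apply, sub_zero] at H
      simp only [← wittVec_smul, ← wittVec_sum] at H
      have := (hv _).1 H m h1 hm
      simpa [hi0] using this
  · rw [pcharConstraint]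
    split_ifs with h hi0
    · subst hi0
      apply LinearMap.ext_ring
      simp only [LinearMap.sub_apply, LinearMap.sum_apply,
        LinearMap.comp_apply, LinearMap.proj_apply, LinearMap.llcomp_apply, LinearMap.lcomp_apply,
        LinearMap.zero_apply, hz, oneDimRho_pow_apply, mul_one, map_smul, if_true, one_smul]
      simp only [vermaRho_pow_wittVec p c lam h.1 h.2, ← wittVec_smul, ← wittVec_sub,
        ← wittVec_sum]
      refine (hv _).2 fun m h1 hm => ?_
      have := H 0 (by omega) m h1 hm
      simpa using this
    · lift i to ℕ using h.1
      apply LinearMap.ext_ring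
      simp only [LinearMap.sub_apply, LinearMap.sum_apply,
        LinearMap.comp_apply, LinearMap.proj_apply, LinearMap.llcomp_apply, LinearMap.lcomp_apply,
        LinearMap.zero_apply, hz, oneDimRho_pow_apply, mul_one, map_smul, hi0, if_false, sub_zero]
      simp only [vermaRho_pow_wittVec p c lam h.1 h.2, ← wittVec_smul, ← wittVec_sum]
      refine (hv _).2 fun m h1 hm => ?_
      have := H i (by omega) m h1 hm
      have hi1 : i ≠ 0 := by exact_mod_cast hi0
      simpa [hi1] using this
    · rfl

/-- Coefficients `a_j` for which `e_j ↦ a_j • x_{p-j}`, with `x_n = (-1)^n / n! • v_n`, satisfies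
the bracket relations of a cocycle with values in `V_χ(λ)`. -/
structure IsWittSeq (p : ℕ) (lam : K) (a : ℕ → K) : Prop where
  pred_eq_zero : a (p - 1) = 0
  self_eq_zero : a p = 0
  bracket : ∀ i j : ℕ, 1 ≤ i → 1 ≤ j → i + 2 ≤ p → j + 2 ≤ p → i + j ≤ p →
    ((j : K) - i) * a (i + j) = ((i + 1) * lam + i + j) * a j - ((j + 1) * lam + i + j) * a i

theorem IsWittSeq.step {p : ℕ} {lam : K} {a : ℕ → K} (h : IsWittSeq p lam a) (hp : 3 < p) {j : ℕ}
    (h1 : 1 ≤ j) (hj : j + 2 ≤ p) :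
    ((j : K) - 1) * a (j + 1) = (2 * lam + 1 + j) * a j - (j + 1) * (lam + 1) * a 1 := by
  have := h.bracket 1 j le_rfl h1 (by omega) hj (by omega)
  rw [add_comm 1 j] at this
  push_cast at this
  linear_combination this

theorem eq_zero_of_step (p : ℕ) [CharP K p] {lam : K} {a : ℕ → K}
    (h : ∀ j : ℕ, 1 ≤ j → j + 2 ≤ p →
      ((j : K) - 1) * a (j + 1) = (2 * lam + 1 + j) * a j - (j + 1) * (lam + 1) * a 1)
    (h1 : a 1 = 0) (h2 : a 2 = 0) {j : ℕ} (hj : 1 ≤ j) (hjp : j < p) : a j = 0 := by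
  induction j, hj using Nat.le_induction with
  | base => exact h1
  | succ j hj ih =>
    rcases hj.eq_or_lt with rfl | hj2
    · exact h2
    · have := h j hj (by omega)
      rw [ih (by omega), h1, mul_zero, mul_zero, sub_zero] at this
      refine (mul_eq_zero.1 this).resolve_left ?_
      have := natCast_ne_zero_of_lt (K := K) p (n := j - 1) (by omega) (by omega)
      rwa [Nat.cast_pred (by omega)] at this

theorem two_ne_zero_of_charP (p : ℕ) [CharP K p] (hp : 3 < p) : (2 : K) ≠ 0 := by
  exact_mod_cast natCast_ne_zero_of_lt (K := K) p (n := 2) (by omega) (by omega)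

theorem natCast_pred_charP (p : ℕ) [CharP K p] (hp : 3 < p) : ((p - 1 : ℕ) : K) = -1 := by
  rw [Nat.cast_pred (by omega), CharP.cast_eq_zero, zero_sub]

theorem IsWittSeq.relation {p : ℕ} [CharP K p] (hp : 3 < p) {lam : K} {a : ℕ → K}
    (h : IsWittSeq p lam a) :
    lam * (lam + 1) * ((2 * lam + 1) * a 2 - (3 * lam + 2) * a 1) = 0 := by
  have hprime : p.Prime := (CharP.char_is_prime_or_zero K p).resolve_right (by omega)
  have hp4 : p ≠ 4 := by rintro rfl; revert hprime; decide
  have hp6 : p ≠ 6 := by rintro rfl; revert hprime; decide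
  have h3 := h.step hp (j := 2) (by omega) (by omega)
  have h4 := h.step hp (j := 3) (by omega) (by omega)
  have h23 := h.bracket 2 3 (by omega) (by omega) (by omega) (by omega) (by omega)
  have h5 : ((4 : ℕ) - 1 : K) * a (4 + 1)
      = (2 * lam + 1 + (4 : ℕ)) * a 4 - ((4 : ℕ) + 1) * (lam + 1) * a 1 := by
    by_cases h5p : p = 5
    · subst h5p
      have h50 : ((5 : ℕ) : K) = 0 := CharP.cast_eq_zero K 5
      have e4 : a 4 = 0 := h.pred_eq_zero
      have e5 : a 5 = 0 := h.self_eq_zero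
      push_cast at h50 ⊢
      norm_num only [e4, e5]
      linear_combination (lam + 1) * a 1 * h50
    · exact h.step hp (by omega) (by omega)
  push_cast at h3 h4 h23 h5
  norm_num only at h3 h4 h23 h5
  refine (mul_eq_zero.1 (?_ : (2 : K) * 2 * _ = 0)).resolve_left
    (mul_ne_zero (two_ne_zero_of_charP (K := K) p hp) (two_ne_zero_of_charP p hp))
  linear_combination -2 * h5 + 6 * h23 - (2 * lam + 5) * h4 - (4 * lam ^ 2 - 10) * h3

/-- Away from `λ ∈ {0, -1}` there are no nonzero sequences. -/
theorem IsWittSeq.eq_zero {p : ℕ} [CharP K p] (hp : 3 < p) {lam : K} {a : ℕ → K}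
    (h : IsWittSeq p lam a) (h0 : lam ≠ 0) (h1 : lam + 1 ≠ 0)
    (ha : 2 * lam + 1 = 0 → a 1 = 0) {j : ℕ} (hj : 1 ≤ j) (hjp : j < p) : a j = 0 := by
  have hp1 := natCast_pred_charP (K := K) p hp
  by_cases h2 : 2 * lam + 1 = 0
  · have ha1 := ha h2
    have key {k : ℕ} := eq_zero_of_step p (lam := lam) (a := fun k => a k - (k - 1) * a 2) (j := k)
      (fun j hj hjp => by
        have := h.step hp hj hjp
        push_cast
        linear_combination this + ((j : K) - 1) * a 2 * h2)
      (by simp [ha1]) (by norm_num)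
    have e := key (k := p - 1) (by omega) (by omega)
    rw [h.pred_eq_zero, hp1] at e
    have e2 : a 2 = 0 := (mul_eq_zero.1 (show 2 * a 2 = 0 by linear_combination e)).resolve_left
      (two_ne_zero_of_charP p hp)
    simpa [e2] using key hj hjp
  · have hr := (mul_eq_zero.1 (h.relation hp)).resolve_left (mul_ne_zero h0 h1)
    obtain ⟨t, ht⟩ : ∃ t, a 1 = t * (2 * lam + 1) := ⟨a 1 / (2 * lam + 1), by field_simp⟩
    have ht2 : a 2 = t * (3 * lam + 2) :=
      mul_left_cancel₀ h2 (by linear_combination hr + (3 * lam + 2) * ht)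
    have key {k : ℕ} := eq_zero_of_step p (lam := lam)
      (a := fun k => a k - t * ((k + 1) * lam + k)) (j := k)
      (fun j hj hjp => by
        have := h.step hp hj hjp
        push_cast
        linear_combination this)
      (by push_cast; linear_combination ht) (by push_cast; linear_combination ht2)
    have e := key (k := p - 1) (by omega) (by omega)
    rw [h.pred_eq_zero, hp1] at e
    have e2 : t = 0 := by linear_combination e
    simpa [e2] using key hj hjp

theorem IsWittSeq.eq_of_lam_eq_zero {p : ℕ} [CharP K p] (hp : 3 < p) {a : ℕ → K}
    (h : IsWittSeq p 0 a) :
    ∃ t, ∀ j : ℕ, 1 ≤ j → j < p → a j = t * (j * (j + 1)) := by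
  have h2 := two_ne_zero_of_charP (K := K) p hp
  obtain ⟨t, ht⟩ : ∃ t, 2 * t = a 2 - 2 * a 1 := ⟨(a 2 - 2 * a 1) / 2, by field_simp⟩
  have key {k : ℕ} := eq_zero_of_step p (lam := 0)
    (a := fun k => a k - (a 1 - 2 * t) * k - t * (k * (k + 1))) (j := k)
    (fun j hj hjp => by
      have := h.step hp hj hjp
      push_cast
      linear_combination this)
    (by push_cast; ring) (by push_cast; linear_combination -ht)
  have e := key (k := p - 1) (by omega) (by omega)
  rw [h.pred_eq_zero, natCast_pred_charP (K := K) p hp] at e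
  refine ⟨t, fun j hj hjp => ?_⟩
  linear_combination key hj hjp + j * e

theorem IsWittSeq.eq_of_lam_eq_neg_one {p : ℕ} [CharP K p] (hp : 3 < p) {a : ℕ → K}
    (h : IsWittSeq p (-1) a) {j : ℕ} (hj : 2 ≤ j) (hjp : j < p) : a j = 0 := by
  have key {k : ℕ} := eq_zero_of_step p (lam := -1)
    (a := fun k => if k = 1 then 0 else a k - a 2) (j := k)
    (fun j hj hjp => by
      have := h.step hp hj hjp
      rcases eq_or_ne j 1 with rfl | hj1
      · simp
      · simp only [Nat.add_eq_right, hj1, if_false, if_true, show j ≠ 0 by omega]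
        linear_combination this)
    (by simp) (by simp)
  have e := key (k := p - 1) (by omega) (by omega)
  rw [if_neg (by omega), h.pred_eq_zero] at e
  have e2 := key (k := j) (by omega) hjp
  rw [if_neg (by omega)] at e2
  linear_combination e2 - e

/-- The family `e_j ↦ a_j • x_{p-j}`, with `x_n = (-1)^n / n! • v_n`. -/
def wittCocycle (p : ℕ) (a : ℕ → K) : ℤ → K →ₗ[K] (Fin p → K) := fun k =>
  LinearMap.toSpanSingleton K _ (wittVec p (Pi.single k.toNat (a k.toNat)))

theorem wittCocycle_smul (p : ℕ) (t : K) (a : ℕ → K) :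
    wittCocycle p (t • a) = t • wittCocycle p a := by
  ext1 k
  apply LinearMap.ext_ring
  simp only [wittCocycle, Pi.smul_apply, LinearMap.smul_apply,
    LinearMap.toSpanSingleton_apply_one, Pi.single_smul, wittVec_smul]

theorem wittCocycle_congr (p : ℕ) [CharP K p] {a b : ℕ → K}
    (h : ∀ j, 1 ≤ j → j ≤ p → a j = b j) : wittCocycle p a = wittCocycle p b := by
  ext1 k
  simp only [wittCocycle]
  congr 1
  refine (wittVec_eq_iff p).2 fun m h1 hm => ?_
  rcases eq_or_ne m k.toNat with rfl | hmk
  · rw [Pi.single_eq_same, Pi.single_eq_same, h _ h1 hm]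
  · rw [Pi.single_eq_of_ne hmk, Pi.single_eq_of_ne hmk]

theorem wittShift_apply_self (lam : K) (i : ℕ) (g : ℕ → K) {j : ℕ} (hj : 1 ≤ j) :
    wittShift lam i g (i + j) = ((i + 1) * lam + i + j) * g j := by
  rw [wittShift, if_pos (by omega), Nat.add_sub_cancel_left]
  push_cast; ring

/-- The restriction of a cocycle to the weight of `K_λ` satisfies the bracket relations. -/
theorem isWittSeq_of_mem_cocycles (p : ℕ) [CharP K p] (hp : 3 < p) (c lam : K)
    (z : ℤ → K →ₗ[K] (Fin p → K)) (g : ℤ → ℕ → K) (hg : ∀ k, z k 1 = wittVec p (g k))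
    (hz : z ∈ cocycles K p 0 (vermaRho K p c lam) (oneDimRho K lam)) :
    IsWittSeq p lam (fun j => g j j) ∧ (2 * lam + 1 = 0 → g 1 1 = 0) := by
  obtain ⟨hs, hb, hc⟩ := (mem_cocycles_iff p hp c lam z g hg).1 hz
  refine ⟨⟨hs _ (by omega) _ (by omega) (by omega), hs _ (by omega) _ (by omega) (by omega),
    fun i j hi hj hip hjp hij => ?_⟩, fun h2 => ?_⟩
  · have := hb i j hip hjp (i + j) (by omega) hij
    rw [wittShift_apply_self lam i _ hj, add_comm i j, wittShift_apply_self lam j _ hi,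
      if_neg (by omega), if_neg (by omega), add_comm j i] at this
    linear_combination this
  · have := hc 1 (by omega) p (by omega) le_rfl
    simp only [one_ne_zero, if_false, sub_zero, Nat.cast_one] at this
    rw [sum_eq_single (p - 1) (fun b hb1 hb2 => by
      rw [zero_pow (by have := mem_range.1 hb1; omega), zero_mul])
      (fun h => absurd (mem_range.2 (by omega)) h), Nat.sub_self, pow_zero, one_mul] at this
    have e := wittShift_one_iterate lam (g 1) (p - 1)
    rw [Nat.sub_add_cancel (by omega), this] at e
    refine (mul_eq_zero.1 e.symm).resolve_left (prod_ne_zero_iff.2 fun l hl => ?_)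
    have hl := mem_range.1 hl
    have := natCast_ne_zero_of_lt (K := K) p (n := l + 1) (by omega) (by omega)
    push_cast at this
    rwa [show 2 * lam + l + 2 = l + 1 by linear_combination h2]

/-- Modulo a coboundary, a cocycle is determined by its restriction to the weight of `K_λ`. -/
theorem exists_coboundary_add (p : ℕ) [CharP K p] (hp : 3 < p) (c lam : K)
    (z : ℤ → K →ₗ[K] (Fin p → K)) (g : ℤ → ℕ → K) (hg : ∀ k, z k 1 = wittVec p (g k))
    (hz : z ∈ cocycles K p 0 (vermaRho K p c lam) (oneDimRho K lam)) :
    ∃ b ∈ coboundaries K p 0 (vermaRho K p c lam) (oneDimRho K lam),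
      z = b + wittCocycle p (fun j => g j j) := by
  obtain ⟨hs, hb, hc⟩ := (mem_cocycles_iff p hp c lam z g hg).1 hz
  have hg0 : g 0 p = 0 := by
    have := hc 0 (by omega) p (by omega) le_rfl
    simp only [if_true, Nat.cast_zero] at this
    rw [sum_congr rfl (g := fun _ => lam ^ (p - 1) * g 0 p)] at this
    · simpa using this
    · intro k hk
      have := mem_range.1 hk
      rw [wittShift_zero_iterate lam _ _ (by omega), CharP.cast_eq_zero, add_zero, ← mul_assoc,
        ← pow_add, Nat.sub_add_cancel (by omega)]
  set f : ℕ → K := fun m => g 0 m / m with hf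
  refine ⟨_, LinearMap.mem_range_self _ (LinearMap.toSpanSingleton K _ (wittVec p f)), ?_⟩
  ext1 k
  apply LinearMap.ext_ring
  rw [Pi.add_apply, LinearMap.add_apply, wittCocycle, LinearMap.toSpanSingleton_apply_one,
    LinearMap.pi_apply]
  split_ifs with hk
  swap
  · rw [LinearMap.zero_apply, LinearMap.zero_apply, zero_add, hg, wittVec_eq_iff p]
    intro m h1 hm
    rw [hs k (by omega) m h1 hm]
    rcases eq_or_ne m k.toNat with rfl | hmk
    · rw [Pi.single_eq_same, hs _ (by omega) _ h1 hm]
    · rw [Pi.single_eq_of_ne hmk]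
  obtain ⟨h0, hk⟩ := hk
  have hN : oneDimRho K lam k 1 = if k = 0 then lam else 0 := by
    simpa using oneDimRho_pow_apply lam k 1 1
  simp only [LinearMap.sub_apply, LinearMap.llcomp_apply, LinearMap.lcomp_apply,
    LinearMap.toSpanSingleton_apply, one_smul, hN]
  rw [hg, vermaRho_wittVec p c lam h0 hk, ← wittVec_smul, ← wittVec_sub, ← wittVec_add,
    wittVec_eq_iff p]
  intro m h1 hm
  have hmf : (m : K) * f m = g 0 m := by
    rcases hm.eq_or_lt with rfl | hm
    · simp [hf, hg0]
    · have := natCast_ne_zero_of_lt (K := K) p h1 hm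
      simp only [hf]; field_simp
  lift k to ℕ using h0
  rcases eq_or_ne k 0 with rfl | hk0
  · simp [wittShift, show 0 < m by omega, Pi.single_eq_of_ne (show m ≠ 0 by omega)]
    linear_combination -hmf
  · have e := hb 0 k (by omega) (by omega) m h1 hm
    rw [wittShift, if_pos (by omega), if_neg hk0, if_pos rfl, zero_add] at e
    simp only [Int.toNat_natCast, Nat.cast_eq_zero, hk0, if_false, zero_smul, sub_zero,
      Pi.add_apply]
    rcases eq_or_ne m k with rfl | hmk
    · simp [wittShift]
    · rw [Pi.single_eq_of_ne hmk, add_zero]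
      have hne : (m : K) - k ≠ 0 := by
        intro h
        have h' : ((m - k : ℤ) : K) = 0 := by push_cast; exact h
        obtain ⟨d, hd⟩ := (CharP.intCast_eq_zero_iff K p _).1 h'
        have hd0 : d ≠ 0 := by rintro rfl; omega
        rcases lt_or_gt_of_ne hd0 with h | h
        · have : (p : ℤ) * d ≤ p * (-1) := mul_le_mul_of_nonneg_left (by omega) (by omega)
          omega
        · have : (p : ℤ) * 1 ≤ p * d := mul_le_mul_of_nonneg_left (by omega) (by omega)
          omega
      apply mul_left_cancel₀ hne
      rw [wittShift] at e ⊢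
      split_ifs at e ⊢ with hkm
      · have e3 : ((m : K) - k) * f (m - k) = g 0 (m - k) := by
          have := natCast_ne_zero_of_lt (K := K) p (n := m - k) (by omega) (by omega)
          rw [Nat.cast_sub hkm.le] at this
          simp only [hf]
          rw [Nat.cast_sub hkm.le]
          field_simp
        simp only [Nat.cast_zero, Nat.sub_zero] at e
        linear_combination -e - ((k + 1) * lam + m) * e3
      · simp only [Nat.cast_zero, Nat.sub_zero] at e
        linear_combination -e

theorem wittShift_single (lam : K) (i j : ℕ) (x : K) {m : ℕ} (_ : 1 ≤ m) :
    wittShift lam i (Pi.single j x) m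
      = if 1 ≤ j ∧ m = i + j then ((i + 1) * lam + i + j) * x else 0 := by
  split_ifs with h
  · rw [h.2, wittShift_apply_self lam i _ h.1, Pi.single_eq_same]
  · rw [wittShift]
    split_ifs with him
    · rw [Pi.single_eq_of_ne (by omega), mul_zero]
    · rfl

theorem mem_cocycles_of_isWittSeq (p : ℕ) [CharP K p] (hp : 3 < p) (c lam : K) (a : ℕ → K)
    (h : IsWittSeq p lam a) (hl : ∃ l : ℕ, l < p - 1 ∧ 2 * lam + l + 2 = 0) :
    wittCocycle p a ∈ cocycles K p 0 (vermaRho K p c lam) (oneDimRho K lam) := by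
  refine (mem_cocycles_iff p hp c lam _ (fun k => Pi.single k.toNat (a k.toNat))
    (by simp [wittCocycle])).2 ⟨fun k hk m h1 hm => ?_, fun i j hi hj m h1 hm => ?_, fun i hi m h1 hm => ?_⟩
  · rcases eq_or_ne m k.toNat with rfl | hmk
    · rw [Pi.single_eq_same]
      rcases (by omega : k.toNat = p - 1 ∨ k.toNat = p) with e | e
      · rw [e, h.pred_eq_zero]
      · rw [e, h.self_eq_zero]
    · rw [Pi.single_eq_of_ne hmk]
  · simp only [Int.toNat_natCast, wittShift_single lam _ _ _ h1]
    rcases eq_or_ne i 0 with rfl | hi0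
    · rcases eq_or_ne j 0 with rfl | hj0
      · simp
      · rcases eq_or_ne m j with rfl | hmj
        · simp [hj0, h1]; ring
        · simp [hj0, hmj]
    · rcases eq_or_ne j 0 with rfl | hj0
      · rcases eq_or_ne m i with rfl | hmi
        · simp [hi0, h1]; ring
        · simp [hi0, hmi]
      · rcases eq_or_ne m (i + j) with rfl | hmij
        · rw [if_neg hi0, if_neg hj0, if_pos (by omega), if_pos (by omega), Pi.single_eq_same]
          linear_combination h.bracket i j (by omega) (by omega) hi hj hm
        · rw [if_neg hi0, if_neg hj0, if_neg (by omega), if_neg (by omega),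
            Pi.single_eq_of_ne hmij]
          ring
  · simp only [Int.toNat_natCast, Int.toNat_zero]
    rcases eq_or_ne i 0 with rfl | hi0
    · simp [wittShift_zero_iterate lam _ _ h1, Pi.single_eq_of_ne (show m ≠ 0 by omega)]
    · simp only [hi0, if_false, sub_zero]
      refine sum_eq_zero fun k hk => ?_
      have hk := mem_range.1 hk
      rcases (by omega : k < p - 1 ∨ k = p - 1) with hk1 | rfl
      · rw [zero_pow (by omega), zero_mul]
      · rw [Nat.sub_self, pow_zero, one_mul]
        by_cases hmi : m ≤ (p - 1) * i
        · exact wittShift_iterate_eq_zero lam _ i (p - 1) h1 hmi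
        · obtain rfl : i = 1 := by
            by_contra hi1
            have : (p - 1) * 2 ≤ (p - 1) * i := Nat.mul_le_mul_left _ (by omega)
            omega
          obtain rfl : m = p - 1 + 1 := by omega
          obtain ⟨l, hlp, hl⟩ := hl
          rw [wittShift_one_iterate, prod_eq_zero (mem_range.2 hlp) hl, zero_mul]

theorem wittCocycle_notMem_coboundaries (p : ℕ) [CharP K p] (hp : 3 < p) (c lam : K)
    {a : ℕ → K} (ha : a 1 ≠ 0) :
    wittCocycle p a ∉ coboundaries K p 0 (vermaRho K p c lam) (oneDimRho K lam) := by
  rintro ⟨f, hf⟩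
  have hg := LinearMap.congr_fun (congrFun hf 1) 1
  obtain ⟨h, hh⟩ := wittVec_surjective (K := K) p (f 1)
  rw [LinearMap.pi_apply, if_pos (by omega)] at hg
  simp only [LinearMap.sub_apply, LinearMap.llcomp_apply, LinearMap.lcomp_apply, wittCocycle,
    LinearMap.toSpanSingleton_apply_one] at hg
  rw [← hh, vermaRho_wittVec p c lam (by omega) (by omega), oneDimRho, if_neg one_ne_zero,
    LinearMap.zero_apply, map_zero, sub_zero, wittVec_eq_iff p] at hg
  exact ha (by simpa [wittShift] using (hg 1 le_rfl (by omega)).symm)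

theorem exists_eq_coboundary_add_wittCocycle (p : ℕ) [CharP K p] (hp : 3 < p) (c lam : K)
    {z : ℤ → K →ₗ[K] (Fin p → K)}
    (hz : z ∈ cocycles K p 0 (vermaRho K p c lam) (oneDimRho K lam)) :
    ∃ a, IsWittSeq p lam a ∧ (2 * lam + 1 = 0 → a 1 = 0) ∧
      ∃ b ∈ coboundaries K p 0 (vermaRho K p c lam) (oneDimRho K lam),
        z = b + wittCocycle p a := by
  choose g hg using fun k => wittVec_surjective (K := K) p (z k 1)
  obtain ⟨h1, h2⟩ := isWittSeq_of_mem_cocycles p hp c lam z g (fun k => (hg k).symm) hz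
  exact ⟨_, h1, h2, exists_coboundary_add p hp c lam z g (fun k => (hg k).symm) hz⟩

theorem finrank_extSpace_eq_one (p : ℕ) [CharP K p] (hp : 3 < p) (c lam : K) (a : ℕ → K)
    (h : IsWittSeq p lam a) (hl : ∃ l : ℕ, l < p - 1 ∧ 2 * lam + l + 2 = 0) (ha : a 1 ≠ 0)
    (huniq : ∀ a', IsWittSeq p lam a' → ∃ t, ∀ j, 1 ≤ j → j < p → a' j = t * a j) :
    Module.finrank K (extSpace K p 0 (vermaRho K p c lam) (oneDimRho K lam)) = 1 := by
  refine finrank_eq_one_iff'.2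
    ⟨Submodule.Quotient.mk ⟨_, mem_cocycles_of_isWittSeq p hp c lam a h hl⟩, fun H => ?_, ?_⟩
  · rw [Submodule.Quotient.mk_eq_zero] at H
    exact wittCocycle_notMem_coboundaries p hp c lam ha H
  · intro w
    obtain ⟨⟨z, hz⟩, rfl⟩ := Submodule.Quotient.mk_surjective _ w
    obtain ⟨a', ha', -, b, hb, rfl⟩ := exists_eq_coboundary_add_wittCocycle p hp c lam hz
    obtain ⟨t, ht⟩ := huniq a' ha'
    have e : wittCocycle p a' = t • wittCocycle p a := by
      rw [← wittCocycle_smul]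
      refine wittCocycle_congr p fun j h1 hj => ?_
      rcases hj.eq_or_lt with rfl | hj
      · simp [ha'.self_eq_zero, h.self_eq_zero]
      · simpa using ht j h1 hj
    refine ⟨t, ?_⟩
    rw [← Submodule.Quotient.mk_smul, eq_comm, Submodule.Quotient.eq]
    simpa [e] using hb

theorem finrank_extSpace_eq_zero (p : ℕ) [CharP K p] (hp : 3 < p) (c lam : K)
    (h0 : lam ≠ 0) (h1 : lam + 1 ≠ 0) :
    Module.finrank K (extSpace K p 0 (vermaRho K p c lam) (oneDimRho K lam)) = 0 := by
  have : Subsingleton (extSpace K p 0 (vermaRho K p c lam) (oneDimRho K lam)) := by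
    refine Submodule.Quotient.subsingleton_iff.2 (eq_top_iff.2 ?_)
    rintro ⟨z, hz⟩ -
    obtain ⟨a, ha, ha1, b, hb, rfl⟩ := exists_eq_coboundary_add_wittCocycle p hp c lam hz
    have e : wittCocycle p a = 0 := by
      rw [wittCocycle_congr p (b := (0 : K) • a), wittCocycle_smul, zero_smul]
      intro j hj hjp
      rw [zero_smul, Pi.zero_apply]
      rcases hjp.eq_or_lt with rfl | hjp
      · exact ha.self_eq_zero
      · exact ha.eq_zero hp h0 h1 ha1 hj hjp
    simpa [e] using hb
  exact Module.finrank_zero_of_subsingleton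

theorem isWittSeq_lam_zero (p : ℕ) [CharP K p] (hp : 3 < p) :
    IsWittSeq p (0 : K) (fun j => j * (j + 1)) where
  pred_eq_zero := by rw [natCast_pred_charP p hp]; ring
  self_eq_zero := by rw [CharP.cast_eq_zero, zero_mul]
  bracket i j _ _ _ _ _ := by push_cast; ring

theorem isWittSeq_lam_neg_one (p : ℕ) (hp : 3 < p) :
    IsWittSeq p (-1 : K) (Pi.single 1 1) where
  pred_eq_zero := Pi.single_eq_of_ne (by omega) _
  self_eq_zero := Pi.single_eq_of_ne (by omega) _
  bracket i j hi hj _ _ _ := by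
    rw [Pi.single_eq_of_ne (show i + j ≠ 1 by omega)]
    have (k : ℕ) : ((k : K) - 1) * (Pi.single 1 1 : ℕ → K) k = 0 := by
      rcases eq_or_ne k 1 with rfl | hk
      · simp
      · rw [Pi.single_eq_of_ne hk, mul_zero]
    linear_combination this i - this j

end WittVerma

open scoped Classical in
/-- If `χ` has height `-1` or `0` (so `Λ(χ) = F_p`) and `λ ∈ Λ(χ)`, then, over `W_0`,
`Ext(K_λ, V_χ(λ)) ≅ K` if `λ ∈ {0, p-1}` and `Ext(K_λ, V_χ(λ)) = 0` otherwise. -/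
theorem ext_Klambda_verma_self_height_le_zero
    (K : Type) [Field K] [IsAlgClosed K] (p : ℕ) [CharP K p] (hp : 3 < p)
    (chi : ℤ → K) (hsupp : ∀ k : ℤ, (k < -1 ∨ (p : ℤ) - 2 < k) → chi k = 0)
    (hheight : ∀ k : ℤ, 0 ≤ k → chi k = 0)
    (lam : K) (hlam : lam ^ p = lam) :
    Module.finrank K (extSpace K p 0
        (vermaRho K p (chi (-1) ^ p) lam) (oneDimRho K lam))
      = if lam = 0 ∨ lam = (p : K) - 1 then 1 else 0 := by
  rw [CharP.cast_eq_zero, zero_sub]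
  split_ifs with h
  · rcases h with rfl | rfl
    · refine finrank_extSpace_eq_one p hp _ 0 _ (isWittSeq_lam_zero p hp) ⟨p - 2, by omega, ?_⟩
        ?_ fun a ha => ha.eq_of_lam_eq_zero hp
      · rw [Nat.cast_sub (by omega), CharP.cast_eq_zero]; push_cast; ring
      · simpa [one_add_one_eq_two] using two_ne_zero_of_charP (K := K) p hp
    · refine finrank_extSpace_eq_one p hp _ (-1) _ (isWittSeq_lam_neg_one p hp)
        ⟨0, by omega, by push_cast; ring⟩ (by simp) fun a ha => ⟨a 1, fun j hj hjp => ?_⟩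
      rcases hj.eq_or_lt with rfl | hj
      · simp
      · rw [ha.eq_of_lam_eq_neg_one hp hj hjp, Pi.single_eq_of_ne (by omega), mul_zero]
  · rw [not_or] at h
    exact finrank_extSpace_eq_zero p hp _ lam h.1 fun e => h.2 (eq_neg_of_add_eq_zero_left e)
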